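/- Let G be a finite group all of whose complex irreducible characters have degree at most 3, and let a, b ∈ ℂG satisfy a² = b² = 0. Then: (i) (1+a, 1+b) is a free pair if and only if χ(a·b) is a free point for some irreducible character χ of G (extended ℂ-linearly to ℂG); (ii) the group ⟨1+a, 1+b⟩ is nilpotent if and only if χ(a·b) = 0 for every irreducible character χ of G. -/

import Mathlib

/-- `u` and `v` form a free pair. -/
def IsFreePair {G : Type*} [Group G] (u v : G) : Prop :=
  Function.Injective ((FreeGroup.lift (fun b : Bool => if b then u else v)) : FreeGroup Bool →* G)

/-- `z : ℂ` is a free point. -/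
def IsFreePoint (z : ℂ) : Prop :=
  ∀ U V : (Matrix (Fin 2) (Fin 2) ℂ)ˣ,
    (U : Matrix (Fin 2) (Fin 2) ℂ) = !![1, 1; 0, 1] →
    (V : Matrix (Fin 2) (Fin 2) ℂ) = !![1, 0; z, 1] →
    IsFreePair U V

/-- An irreducible finite-dimensional complex representation of a group `G`. -/
structure IrredGRep (G : Type) [Group G] where
  V : Type
  [acg : AddCommGroup V]
  [mod : Module ℂ V]
  ρ : Representation ℂ G V
  nontrivial : Nontrivial V
  findim : FiniteDimensional ℂ V
  irred : ∀ W : Submodule ℂ V, (∀ g : G, W ≤ W.comap (ρ g)) → W = ⊥ ∨ W = ⊤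

attribute [instance] IrredGRep.acg IrredGRep.mod

/-- The character of an irreducible representation, extended `ℂ`-linearly to the group
algebra `ℂG`: for `w ∈ ℂG`, it is the trace of the action of `w` on the representation
space. -/
noncomputable def IrredGRep.char {G : Type} [Group G] (R : IrredGRep G)
    (w : MonoidAlgebra ℂ G) : ℂ :=
  LinearMap.trace ℂ R.V (R.ρ.asAlgebraHom w)

open scoped commutatorElement

/-! ### Group theory -/

theorem aux_mem_center {H : Type*} [Group H] {x y : H} (h : Subgroup.closure {x, y} = ⊤)
    {g : H} (hx : Commute g x) (hy : Commute g y) : g ∈ Subgroup.center H := by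
  have : (⊤ : Subgroup H) ≤ Subgroup.centralizer {g} := by
    rw [← h, Subgroup.closure_le]
    rintro k (rfl | rfl)
    · exact Subgroup.mem_centralizer_singleton_iff.2 hx.symm.eq
    · exact Subgroup.mem_centralizer_singleton_iff.2 hy.symm.eq
  rw [Subgroup.mem_center_iff]
  intro k
  exact Subgroup.mem_centralizer_singleton_iff.1 (this (Subgroup.mem_top k))

theorem aux_nilp_two {H : Type*} [Group H] {x y : H} (h : Subgroup.closure {x, y} = ⊤)
    (h1 : Commute ⁅x, y⁆ x) (h2 : Commute ⁅x, y⁆ y) : Group.IsNilpotent H := by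
  have hc := aux_mem_center h h1 h2
  apply Group.of_quotient_center_nilpotent
  let π := QuotientGroup.mk' (Subgroup.center H)
  have hcl : Subgroup.closure {π x, π y} = ⊤ := by
    have := congrArg (Subgroup.map π) h
    rw [MonoidHom.map_closure, Set.image_pair, Subgroup.map_top_of_surjective _
      (QuotientGroup.mk'_surjective _)] at this
    exact this
  have hxy : Commute (π x) (π y) := by
    rw [← commutatorElement_eq_one_iff_commute, ← map_commutatorElement]
    exact (QuotientGroup.eq_one_iff _).2 hc
  have hxc := aux_mem_center hcl (Commute.refl (π x)) hxy
  have hyc := aux_mem_center hcl hxy.symm (Commute.refl (π y))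
  have htop : Subgroup.center (H ⧸ Subgroup.center H) = ⊤ := by
    rw [eq_top_iff, ← hcl, Subgroup.closure_le]
    rintro k (rfl | rfl)
    · exact hxc
    · exact hyc
  exact ⟨⟨1, by rw [Subgroup.upperCentralSeries_one, htop]⟩⟩

/-- Two nontrivial normal subgroups of a free group meet nontrivially. -/
theorem aux_inter {ι : Type} (N M : Subgroup (FreeGroup ι)) [N.Normal] [M.Normal]
    (hN : N ≠ ⊥) (hM : M ≠ ⊥) : N ⊓ M ≠ ⊥ := by
  obtain ⟨x, hx, hx1⟩ := N.bot_or_exists_ne_one.resolve_left hN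
  obtain ⟨y, hy, hy1⟩ := M.bot_or_exists_ne_one.resolve_left hM
  intro hbot
  have key : ∀ g, g ∈ N → g ∈ M → g = 1 := fun g h1 h2 => by
    have : g ∈ N ⊓ M := ⟨h1, h2⟩
    rwa [hbot, Subgroup.mem_bot] at this
  have hcomm : Commute x y := by
    rw [← commutatorElement_eq_one_iff_commute]
    exact key _ (Subgroup.commutator_le_left N M (Subgroup.commutator_mem_commutator hx hy))
      (Subgroup.commutator_le_right N M (Subgroup.commutator_mem_commutator hx hy))
  let K := Subgroup.closure {x, y}
  have hKc : ∀ p q : K, p * q = q * p := by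
    have : ∀ a ∈ ({x, y} : Set (FreeGroup ι)), ∀ b ∈ ({x, y} : Set (FreeGroup ι)),
        a * b = b * a := by
      rintro a (rfl | rfl) b (rfl | rfl)
      · rfl
      · exact hcomm.eq
      · exact hcomm.symm.eq
      · rfl
    letI := Subgroup.closureCommGroupOfComm this
    exact fun p q => mul_comm p q
  obtain ⟨κ, ⟨B⟩⟩ := (inferInstance : IsFreeGroup K).nonempty_basis
  have hsub : Subsingleton κ := by
    classical
    refine ⟨fun i j => ?_⟩
    by_contra hij
    have h := congrArg B.repr (hKc (B i) (B j))
    simp only [map_mul, FreeGroupBasis.repr_apply_coe] at h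
    have h' := congrArg FreeGroup.toWord h
    simp [FreeGroup.toWord_mul, FreeGroup.toWord_of, FreeGroup.reduce] at h'
    exact hij h'.1
  have hcyc : IsCyclic K := by
    rcases isEmpty_or_nonempty κ with he | ⟨⟨i⟩⟩
    · have : Subsingleton K := B.repr.toEquiv.subsingleton
      infer_instance
    · letI : Unique κ := ⟨⟨i⟩, fun j => Subsingleton.elim _ _⟩
      exact isCyclic_of_surjective B.repr.symm B.repr.symm.surjective
  obtain ⟨t, ht⟩ := hcyc.exists_generator
  obtain ⟨i, hi⟩ := ht ⟨x, Subgroup.subset_closure (by simp)⟩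
  obtain ⟨j, hj⟩ := ht ⟨y, Subgroup.subset_closure (by simp)⟩
  have hi' : (t : FreeGroup ι) ^ i = x := congrArg Subtype.val hi
  have hj' : (t : FreeGroup ι) ^ j = y := congrArg Subtype.val hj
  have hxj : x ^ j = y ^ i := by rw [← hi', ← hj', ← zpow_mul, ← zpow_mul, mul_comm]
  have h1 : x ^ j = 1 := key _ (N.zpow_mem hx j) (hxj ▸ M.zpow_mem hy i)
  have hj0 : j = 0 := by
    by_contra hj0
    exact hx1 ((IsMulTorsionFree.zpow_eq_one_iff_left hj0).1 h1)
  exact hy1 (by rw [← hj', hj0, zpow_zero])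

/-! ### Ring computations -/

/-- Value of the commutator. -/
theorem aux_comm_val {S : Type*} [Ring S] {a b : S} (ha : a * a = 0) (hb : b * b = 0)
    (hab : a * b * a = 0) (hba : b * a * b = 0) (α β : Sˣ) (hα : (α : S) = 1 + a)
    (hβ : (β : S) = 1 + b) : Commute ⁅α, β⁆ α ∧ Commute ⁅α, β⁆ β := by
  have hαi : ((α⁻¹ : Sˣ) : S) = 1 - a := by
    rw [Units.inv_eq_of_mul_eq_one_right]
    rw [hα]; simp [mul_sub, add_mul, ha]
  have hβi : ((β⁻¹ : Sˣ) : S) = 1 - b := by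
    rw [Units.inv_eq_of_mul_eq_one_right]
    rw [hβ]; simp [mul_sub, add_mul, hb]
  have hv : ((⁅α, β⁆ : Sˣ) : S) = 1 + a * b - b * a := by
    rw [commutatorElement_def]
    push_cast
    rw [hα, hβ, hαi, hβi]
    have e1 : a * b * a * b = 0 := by rw [hab, zero_mul]
    have e2 : a * a * b = 0 := by rw [ha, zero_mul]
    simp only [mul_sub, mul_add, add_mul, mul_one, one_mul, ha, hab, hba, e1]
    noncomm_ring
    rw [← mul_assoc b, hba]
    simp [hb]
  have hab' : a * (b * a) = 0 := by rw [← mul_assoc, hab]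
  have hba' : b * (a * b) = 0 := by rw [← mul_assoc, hba]
  constructor
  · apply Units.ext
    push_cast
    rw [hv, hα]
    have e2 : a * (a * b) = 0 := by rw [← mul_assoc, ha, zero_mul]
    have e3 : b * a * a = 0 := by rw [mul_assoc, ha, mul_zero]
    simp only [mul_sub, sub_mul, mul_add, add_mul, mul_one, one_mul, hab, hab', e2, e3]
    abel
  · apply Units.ext
    push_cast
    rw [hv, hβ]
    have e2 : b * (b * a) = 0 := by rw [← mul_assoc, hb, zero_mul]
    have e3 : a * b * b = 0 := by rw [mul_assoc, hb, mul_zero]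
    simp only [mul_sub, sub_mul, mul_add, add_mul, mul_one, one_mul, hba, hba', e2, e3]
    abel

/-- The evaluation of words. -/
abbrev aux_ev {H : Type*} [Group H] (u v : H) : FreeGroup Bool →* H :=
  FreeGroup.lift (fun b : Bool => if b then u else v)

theorem aux_ev_map {H K : Type*} [Group H] [Group K] (f : H →* K) (u v : H)
    (w : FreeGroup Bool) : f (aux_ev u v w) = aux_ev (f u) (f v) w := by
  have : f.comp (aux_ev u v) = aux_ev (f u) (f v) := by
    ext b; cases b <;> simp
  exact DFunLike.congr_fun this w

theorem aux_ev_range {H : Type*} [Group H] (u v : H) :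
    (aux_ev u v).range = Subgroup.closure {u, v} := by
  apply le_antisymm
  · rw [FreeGroup.range_lift_eq_closure, Subgroup.closure_le]
    rintro _ ⟨b, rfl⟩
    cases b
    · exact Subgroup.subset_closure (by simp)
    · exact Subgroup.subset_closure (by simp)
  · rw [Subgroup.closure_le]
    rintro _ (rfl | rfl)
    · exact ⟨FreeGroup.of true, by simp⟩
    · exact ⟨FreeGroup.of false, by simp⟩

theorem aux_word_ne : ⁅⁅FreeGroup.of true, FreeGroup.of false⁆, FreeGroup.of true⁆ ≠ 1 := by
  decide

/-- The standard matrices. -/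
def auxU : (Matrix (Fin 2) (Fin 2) ℂ)ˣ :=
  ⟨!![1, 1; 0, 1], !![1, -1; 0, 1], by ext i j; fin_cases i <;> fin_cases j <;> simp,
    by ext i j; fin_cases i <;> fin_cases j <;> simp⟩

def auxV (z : ℂ) : (Matrix (Fin 2) (Fin 2) ℂ)ˣ :=
  ⟨!![1, 0; z, 1], !![1, 0; -z, 1], by ext i j; fin_cases i <;> fin_cases j <;> simp,
    by ext i j; fin_cases i <;> fin_cases j <;> simp⟩

theorem aux_free_iff (z : ℂ) :
    IsFreePoint z ↔ Function.Injective (aux_ev auxU (auxV z)) := by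
  constructor
  · intro h
    exact h _ _ rfl rfl
  · intro h U V hU hV
    have h1 : U = auxU := Units.ext hU
    have h2 : V = auxV z := Units.ext hV
    subst h1 h2
    exact h

theorem aux_not_free_zero : ¬ IsFreePoint 0 := by
  rw [aux_free_iff]
  intro h
  have h1 : auxV 0 = 1 := by
    apply Units.ext
    ext i j; fin_cases i <;> fin_cases j <;> simp [auxV]
  have := @h (FreeGroup.of false) 1 (by simp [h1])
  revert this
  decide

/-- The embedding of the 2×2 matrices. -/
theorem aux_embed {S : Type*} [Ring S] [Algebra ℂ S] {A B : S} {z : ℂ} (hz : z ≠ 0)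
    (hA : A * A = 0) (hB : B * B = 0) (hABA : A * B * A = z • A) (hBAB : B * A * B = z • B)
    (hA0 : A ≠ 0) :
    ∃ Ψ : Matrix (Fin 2) (Fin 2) ℂ →* S, Function.Injective Ψ ∧
      Ψ auxU = 1 + A ∧ Ψ (auxV z) = 1 + B := by
  have r1 : A * (B * A) = z • A := by rw [← mul_assoc, hABA]
  have r2 : B * (A * B) = z • B := by rw [← mul_assoc, hBAB]
  have r3 : A * (A * B) = 0 := by rw [← mul_assoc, hA, zero_mul]
  have r4 : B * (B * A) = 0 := by rw [← mul_assoc, hB, zero_mul]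
  have r5 : A * B * B = 0 := by rw [mul_assoc, hB, mul_zero]
  have r6 : B * A * A = 0 := by rw [mul_assoc, hA, mul_zero]
  have r7 : A * B * (A * B) = z • (A * B) := by rw [← mul_assoc, hABA, smul_mul_assoc]
  have r8 : B * A * (B * A) = z • (B * A) := by rw [← mul_assoc, hBAB, smul_mul_assoc]
  have r9 : A * B * (B * A) = 0 := by rw [← mul_assoc, r5, zero_mul]
  have r10 : B * A * (A * B) = 0 := by rw [← mul_assoc, r6, zero_mul]
  let φ : Matrix (Fin 2) (Fin 2) ℂ → S := fun M =>
    (M 0 0 * z⁻¹) • (A * B) + M 0 1 • A + (M 1 0 * z⁻¹) • B + (M 1 1 * z⁻¹) • (B * A)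
  have hφmul : ∀ M N, φ (M * N) = φ M * φ N := by
    intro M N
    simp only [φ, Matrix.mul_apply, Fin.sum_univ_two, mul_add, add_mul, smul_mul_smul_comm,
      hA, hB, hABA, hBAB, r1, r2, r3, r4, r5, r6, r7, r8, r9, r10, smul_zero, smul_smul]
    match_scalars <;> field_simp
  have hφsub : ∀ M N, φ (M - N) = φ M - φ N := by
    intro M N
    simp only [φ, Matrix.sub_apply]
    module
  have hφ0 : ∀ M, φ M = 0 → M = 0 := by
    intro M hM
    have e1 : A * φ M * A = (M 1 0) • A := by
      simp only [φ, mul_add, add_mul, mul_smul_comm, smul_mul_assoc, hA, hABA, r1, r3,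
        zero_mul, smul_zero, smul_smul]
      match_scalars; field_simp
    have e2 : φ M * A = (M 0 0) • A + (M 1 0 * z⁻¹) • (B * A) := by
      simp only [φ, add_mul, smul_mul_assoc, hA, hABA, r6, smul_zero, smul_smul]
      match_scalars <;> field_simp
    have e3 : A * φ M = (M 1 0 * z⁻¹) • (A * B) + (M 1 1) • A := by
      simp only [φ, mul_add, mul_smul_comm, hA, r1, r3, smul_zero, smul_smul]
      match_scalars <;> field_simp
    rw [hM] at e1 e2 e3
    have m10 : M 1 0 = 0 := by simpa [hA0] using e1.symm
    have m00 : M 0 0 = 0 := by simpa [hA0, m10] using e2.symm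
    have m11 : M 1 1 = 0 := by simpa [hA0, m10] using e3.symm
    have m01 : M 0 1 = 0 := by
      have := hM
      simpa [φ, m10, m00, m11, hA0] using this
    ext i j
    fin_cases i <;> fin_cases j <;> simp [m10, m00, m11, m01]
  refine ⟨{ toFun := fun M => φ M + (1 - φ 1), map_one' := by abel, map_mul' := ?_ }, ?_, ?_, ?_⟩
  · intro M N
    have h1 : φ M * φ 1 = φ M := by rw [← hφmul, mul_one]
    have h2 : φ 1 * φ N = φ N := by rw [← hφmul, one_mul]
    have h3 : φ 1 * φ 1 = φ 1 := by rw [← hφmul, one_mul]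
    simp only [hφmul, mul_add, add_mul, mul_sub, sub_mul, h1, h2, h3, mul_one, one_mul]
    abel
  · intro M N h
    have h' : φ M + (1 - φ 1) = φ N + (1 - φ 1) := h
    have h2 := add_right_cancel h'
    exact sub_eq_zero.1 (hφ0 _ (by rw [hφsub, h2, sub_self]))
  · change φ auxU + (1 - φ 1) = 1 + A
    simp only [φ, auxU]
    simp
    abel
  · change φ (auxV z) + (1 - φ 1) = 1 + B
    simp only [φ, auxV]
    simp [hz]
    abel

theorem aux_ev_iff {S : Type*} [Ring S] [Algebra ℂ S] {A B : S} {z : ℂ} (hz : z ≠ 0)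
    (hA : A * A = 0) (hB : B * B = 0) (hABA : A * B * A = z • A) (hBAB : B * A * B = z • B)
    (hA0 : A ≠ 0) (u v : Sˣ) (hu : (u : S) = 1 + A) (hv : (v : S) = 1 + B)
    (w : FreeGroup Bool) : aux_ev u v w = 1 ↔ aux_ev auxU (auxV z) w = 1 := by
  obtain ⟨Ψ, hΨ, h1, h2⟩ := aux_embed hz hA hB hABA hBAB hA0
  have hu' : u = Units.map Ψ auxU := Units.ext (by rw [hu, ← h1]; rfl)
  have hv' : v = Units.map Ψ (auxV z) := Units.ext (by rw [hv, ← h2]; rfl)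
  rw [hu', hv', ← aux_ev_map]
  exact map_eq_one_iff _ (Units.map_injective hΨ)

/-! ### The matrix group is not nilpotent -/

theorem aux_scalar {z : ℂ} (hz : z ≠ 0) {C : Matrix (Fin 2) (Fin 2) ℂ}
    (h1 : C * auxU = auxU * C) (h2 : C * auxV z = auxV z * C) :
    C = C 0 0 • (1 : Matrix (Fin 2) (Fin 2) ℂ) := by
  have a1 := congrFun (congrFun h1 0) 0
  have a2 := congrFun (congrFun h1 0) 1
  have a3 := congrFun (congrFun h2 0) 0
  simp [auxU, auxV, Matrix.mul_apply, Fin.sum_univ_two, hz] at a1 a2 a3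
  ext i j
  fin_cases i <;> fin_cases j <;> simp [a1, a3] 
  linear_combination -a2

theorem aux_not_nilp {z : ℂ} (hz : z ≠ 0) :
    ¬ Group.IsNilpotent (Subgroup.closure {auxU, auxV z}) := by
  rintro ⟨n, hn⟩
  set H := Subgroup.closure {auxU, auxV z} with hH
  let u : H := ⟨auxU, Subgroup.subset_closure (by simp)⟩
  let v : H := ⟨auxV z, Subgroup.subset_closure (by simp)⟩
  have hcl : Subgroup.closure {u, v} = ⊤ := by
    apply Subgroup.map_injective H.subtype_injective
    rw [MonoidHom.map_closure, Set.image_pair, ← MonoidHom.range_eq_map, Subgroup.range_subtype]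
    rfl
  -- if the commutator is central it is trivial
  have key : ∀ x g : H, (g : (Matrix (Fin 2) (Fin 2) ℂ)ˣ).1.trace = 2 →
      x * g * x⁻¹ * g⁻¹ ∈ Subgroup.center H → Commute x g := by
    intro x g hg hc
    set c := x * g * x⁻¹ * g⁻¹ with hcdef
    have hc' := Subgroup.mem_center_iff.1 hc
    have s1 := congrArg (fun t : H => (t : (Matrix (Fin 2) (Fin 2) ℂ)ˣ).1) (hc' u).symm
    have s2 := congrArg (fun t : H => (t : (Matrix (Fin 2) (Fin 2) ℂ)ˣ).1) (hc' v).symm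
    have s3 := aux_scalar hz (C := (c : (Matrix (Fin 2) (Fin 2) ℂ)ˣ).1) s1 s2
    have e : c * g = x * g * x⁻¹ := by rw [hcdef]; group
    have e' := congrArg (fun t : H => (t : (Matrix (Fin 2) (Fin 2) ℂ)ˣ).1.trace) e
    simp only [Subgroup.coe_mul, Units.val_mul] at e'
    rw [Matrix.trace_mul_comm (_ * _), ← mul_assoc] at e'
    have hinv : ((x⁻¹ : H) : (Matrix (Fin 2) (Fin 2) ℂ)ˣ).1 *
        (x : (Matrix (Fin 2) (Fin 2) ℂ)ˣ).1 = 1 := by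
      rw [Subgroup.coe_inv]; exact Units.inv_mul _
    rw [hinv, one_mul, s3, smul_mul_assoc, one_mul, Matrix.trace_smul, hg] at e'
    have h1 : ((c : (Matrix (Fin 2) (Fin 2) ℂ)ˣ).1 0 0) = 1 := by
      have h2 : (2 : ℂ) ≠ 0 := two_ne_zero
      apply mul_right_cancel₀ h2
      simpa using e'
    rw [h1, one_smul] at s3
    have hc1 : c = 1 := Subtype.ext (Units.ext s3)
    rw [hc1, one_mul] at e
    exact (eq_mul_inv_iff_mul_eq.1 e).symm
  have hall : ∀ m, Subgroup.upperCentralSeries H m ≤ Subgroup.center H := by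
    intro m
    induction m with
    | zero => simp
    | succ m ih =>
      intro x hx
      rw [Subgroup.mem_upperCentralSeries_succ_iff] at hx
      refine aux_mem_center hcl (key _ _ ?_ (ih (hx u))) (key _ _ ?_ (ih (hx v)))
      · simp [u, auxU, Matrix.trace_fin_two]; norm_num
      · simp [v, auxV, Matrix.trace_fin_two]; norm_num
  have hu : u ∈ Subgroup.center H := hall n (hn ▸ Subgroup.mem_top u)
  have huv := Subgroup.mem_center_iff.1 hu v
  have s1 := congrArg (fun t : H => (t : (Matrix (Fin 2) (Fin 2) ℂ)ˣ).1 0 0) huv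
  simp [u, v, auxU, auxV, Matrix.mul_apply, Fin.sum_univ_two] at s1
  exact hz s1

/-! ### Linear algebra -/

theorem aux_rank_one {V : Type*} [AddCommGroup V] [Module ℂ V] [FiniteDimensional ℂ V]
    (hV : Module.finrank ℂ V ≤ 3) (A B : Module.End ℂ V) (hA : A * A = 0) :
    A * B * A = LinearMap.trace ℂ V (A * B) • A := by
  have h1 : LinearMap.range A ≤ LinearMap.ker A := by
    rintro _ ⟨x, rfl⟩
    exact LinearMap.congr_fun hA x
  have h2 := Submodule.finrank_mono h1
  have h3 := LinearMap.finrank_range_add_finrank_ker A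
  have h4 : Module.finrank ℂ (LinearMap.range A) ≤ 1 := by omega
  obtain ⟨u, hu⟩ := finrank_le_one_iff.1 h4
  choose c hc using fun x : V => hu ⟨A x, x, rfl⟩
  by_cases hu0 : (u : V) = 0
  · have : A = 0 := by
      ext x
      have := congrArg Subtype.val (hc x)
      simpa [hu0] using this.symm
    simp [this]
  have hc' : ∀ x, c x • (u : V) = A x := fun x => congrArg Subtype.val (hc x)
  let f : V →ₗ[ℂ] ℂ :=
    { toFun := c
      map_add' := fun x y => by
        apply smul_left_injective ℂ hu0
        simp only [add_smul, hc', map_add]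
      map_smul' := fun r x => by
        apply smul_left_injective ℂ hu0
        simp only [hc', map_smul, RingHom.id_apply, smul_eq_mul, mul_smul] }
  have hAB : A * B = (f.comp B).smulRight (u : V) := by
    ext x
    simp [f, hc']
  have ht : LinearMap.trace ℂ V (A * B) = c (B u) := by
    rw [hAB, LinearMap.trace_smulRight]; rfl
  rw [ht]
  ext x
  simp only [Module.End.mul_apply, LinearMap.smul_apply]
  rw [← hc' x, map_smul, map_smul, ← hc' (B u), smul_comm]

/-! ### Semisimplicity -/

theorem aux_simple_ind {R : Type*} [Ring R] [IsSemisimpleRing R] (P : Submodule R R → Prop)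
    (h0 : P ⊥) (hs : ∀ S : Submodule R R, IsSimpleModule R S → P S)
    (hsup : ∀ S T, P S → P T → P (S ⊔ T)) : P ⊤ := by
  obtain ⟨W, hW, hmax⟩ := WellFounded.has_min (wellFounded_gt (α := Submodule R R)) {W | P W} ⟨_, h0⟩
  have : W = ⊤ := by
    rw [eq_top_iff, ← IsSemisimpleModule.sSup_simples_eq_top R R, sSup_le_iff]
    intro S hS
    by_contra hle
    exact hmax (W ⊔ S) (hsup _ _ hW (hs S hS)) (left_lt_sup.2 hle)
  rwa [← this]

/-- Irreducible representation from a simple left ideal. -/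
noncomputable def auxRep {G : Type} [Group G] [Fintype G]
    (S : Submodule (MonoidAlgebra ℂ G) (MonoidAlgebra ℂ G))
    (hS : IsSimpleModule (MonoidAlgebra ℂ G) S) : IrredGRep G where
  V := S
  ρ := ((Algebra.lsmul ℂ ℂ S : MonoidAlgebra ℂ G →ₐ[ℂ] Module.End ℂ S) :
    MonoidAlgebra ℂ G →* Module.End ℂ S).comp (MonoidAlgebra.of ℂ G)
  nontrivial := IsSimpleModule.nontrivial (MonoidAlgebra ℂ G) S
  findim := by
    have : FiniteDimensional ℂ (MonoidAlgebra ℂ G) := inferInstance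
    exact FiniteDimensional.of_injective (S.subtype.restrictScalars ℂ) S.subtype_injective
  irred := by
    intro W hW
    have hall : ∀ (r : MonoidAlgebra ℂ G) (x : S), x ∈ W → r • x ∈ W := by
      intro r x hx
      induction r using MonoidAlgebra.induction_on with
      | of g => exact hW g hx
      | add p q hp hq => rw [add_smul]; exact W.add_mem hp hq
      | smul c p hp => rw [smul_assoc]; exact W.smul_mem c hp
    let W' : Submodule (MonoidAlgebra ℂ G) S :=
      { carrier := W
        add_mem' := W.add_mem
        zero_mem' := W.zero_mem
        smul_mem' := fun r x hx => hall r x hx }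
    rcases eq_bot_or_eq_top W' with h | h
    · left
      ext x
      have := SetLike.ext_iff.1 h x
      exact this
    · right
      ext x
      have := SetLike.ext_iff.1 h x
      exact this

theorem auxRep_apply {G : Type} [Group G] [Fintype G]
    (S : Submodule (MonoidAlgebra ℂ G) (MonoidAlgebra ℂ G))
    (hS : IsSimpleModule (MonoidAlgebra ℂ G) S) (r : MonoidAlgebra ℂ G) (x : S) :
    ((auxRep S hS).ρ.asAlgebraHom r : S → S) x = r • x := by
  have : (auxRep S hS).ρ.asAlgebraHom =
      (Algebra.lsmul ℂ ℂ S : MonoidAlgebra ℂ G →ₐ[ℂ] Module.End ℂ S) := by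
    apply MonoidAlgebra.algHom_ext
    · intro g
      rw [Representation.asAlgebraHom_single_one]
      rfl
    · exact Subsingleton.elim _ _
  exact LinearMap.congr_fun (DFunLike.congr_fun this r) x

theorem aux_rels {G : Type} [Group G] (R : IrredGRep G) (hR : Module.finrank ℂ R.V ≤ 3)
    (a b : MonoidAlgebra ℂ G) (ha : a * a = 0) (hb : b * b = 0) :
    R.ρ.asAlgebraHom a * R.ρ.asAlgebraHom b * R.ρ.asAlgebraHom a =
      R.char (a * b) • R.ρ.asAlgebraHom a ∧
    R.ρ.asAlgebraHom b * R.ρ.asAlgebraHom a * R.ρ.asAlgebraHom b =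
      R.char (a * b) • R.ρ.asAlgebraHom b := by
  have := R.findim
  have hA : R.ρ.asAlgebraHom a * R.ρ.asAlgebraHom a = 0 := by rw [← map_mul, ha, map_zero]
  have hB : R.ρ.asAlgebraHom b * R.ρ.asAlgebraHom b = 0 := by rw [← map_mul, hb, map_zero]
  have hc : R.char (a * b) =
      LinearMap.trace ℂ R.V (R.ρ.asAlgebraHom a * R.ρ.asAlgebraHom b) := by
    rw [IrredGRep.char, map_mul]
  rw [hc]
  refine ⟨aux_rank_one hR _ _ hA, ?_⟩
  rw [LinearMap.trace_mul_comm]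
  exact aux_rank_one hR _ _ hB

theorem aux_rep_ev {G : Type} [Group G] (R : IrredGRep G) (hR : Module.finrank ℂ R.V ≤ 3)
    (a b : MonoidAlgebra ℂ G) (ha : a * a = 0) (hb : b * b = 0) (α β : (MonoidAlgebra ℂ G)ˣ)
    (hα : (α : MonoidAlgebra ℂ G) = 1 + a) (hβ : (β : MonoidAlgebra ℂ G) = 1 + b)
    (hz : R.char (a * b) ≠ 0) (w : FreeGroup Bool) :
    Units.map (R.ρ.asAlgebraHom : MonoidAlgebra ℂ G →* Module.End ℂ R.V) (aux_ev α β w) = 1 ↔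
      aux_ev auxU (auxV (R.char (a * b))) w = 1 := by
  have hA : R.ρ.asAlgebraHom a * R.ρ.asAlgebraHom a = 0 := by rw [← map_mul, ha, map_zero]
  have hB : R.ρ.asAlgebraHom b * R.ρ.asAlgebraHom b = 0 := by rw [← map_mul, hb, map_zero]
  obtain ⟨h1, h2⟩ := aux_rels R hR a b ha hb
  rw [aux_ev_map]
  refine aux_ev_iff hz hA hB h1 h2 ?_ _ _ ?_ ?_ w
  · intro h0
    apply hz
    rw [IrredGRep.char, map_mul, h0, zero_mul, map_zero]
  · simp [hα]
  · simp [hβ]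

/-- **Corollary 3.3.** Let `G` be a finite group all of whose complex irreducible
characters have degree at most `3`, and let `a, b ∈ ℂG` with `a² = b² = 0`, with
corresponding units `α = 1 + a`, `β = 1 + b`. Then:
(i) `(1+a, 1+b)` is a free pair iff `χ(ab)` is a free point for some irreducible
character `χ` of `G`; and
(ii) `⟨1+a, 1+b⟩` is nilpotent iff `χ(ab) = 0` for every irreducible character `χ`. -/
theorem free_pair_iff_character_free (G : Type) [Group G] [Fintype G]
    (hdeg : ∀ R : IrredGRep G, Module.finrank ℂ R.V ≤ 3)
    (a b : MonoidAlgebra ℂ G) (ha : a ^ 2 = 0) (hb : b ^ 2 = 0)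
    (α β : (MonoidAlgebra ℂ G)ˣ)
    (hα : (α : MonoidAlgebra ℂ G) = 1 + a) (hβ : (β : MonoidAlgebra ℂ G) = 1 + b) :
    (IsFreePair α β ↔ ∃ R : IrredGRep G, IsFreePoint (R.char (a * b))) ∧
    (Group.IsNilpotent ↥(Subgroup.closure {α, β}) ↔
      ∀ R : IrredGRep G, R.char (a * b) = 0) := by
  have ha' : a * a = 0 := by rw [← pow_two, ha]
  have hb' : b * b = 0 := by rw [← pow_two, hb]
  have : IsSemisimpleRing (MonoidAlgebra ℂ G) := inferInstance
  refine ⟨⟨?_, ?_⟩, ?_, ?_⟩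
  · -- free pair gives a free point
    intro hfree
    by_contra! hno
    have hnorm : ∀ (S : Submodule (MonoidAlgebra ℂ G) (MonoidAlgebra ℂ G)),
        ∃ K : Subgroup (FreeGroup Bool), K.Normal ∧
          ∀ w, w ∈ K ↔ ∀ s ∈ S, ((aux_ev α β w : (MonoidAlgebra ℂ G)ˣ) : MonoidAlgebra ℂ G) * s = s := by
      intro S
      let act : (MonoidAlgebra ℂ G)ˣ →* Module.End ℂ S :=
        ((Algebra.lsmul ℂ ℂ S : MonoidAlgebra ℂ G →ₐ[ℂ] Module.End ℂ S) :
          MonoidAlgebra ℂ G →* Module.End ℂ S).comp (Units.coeHom _)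
      refine ⟨(act.comp (aux_ev α β)).ker, inferInstance, fun w => ?_⟩
      rw [MonoidHom.mem_ker, LinearMap.ext_iff]
      constructor
      · intro h s hs
        exact congrArg Subtype.val (h ⟨s, hs⟩)
      · intro h s
        exact Subtype.ext (h s.1 s.2)
    choose K hKn hK using hnorm
    have hKtop : K ⊤ ≠ ⊥ := by
      refine aux_simple_ind (fun S => K S ≠ ⊥) ?_ ?_ ?_
      · intro h
        have : FreeGroup.of true ∈ K ⊥ := by
          rw [hK]
          intro s hs
          rw [(Submodule.mem_bot _).1 hs, mul_zero]
        rw [h, Subgroup.mem_bot] at this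
        exact FreeGroup.of_ne_one _ this
      · intro S hS
        set R := auxRep S hS with hR
        suffices h : ∃ w : FreeGroup Bool, w ≠ 1 ∧
            Units.map (R.ρ.asAlgebraHom : MonoidAlgebra ℂ G →* Module.End ℂ R.V)
              (aux_ev α β w) = 1 by
          obtain ⟨w, hw, hw1⟩ := h
          intro hbot
          apply hw
          rw [← Subgroup.mem_bot, ← hbot, hK]
          intro s hs
          have h2 : R.ρ.asAlgebraHom ((aux_ev α β w : (MonoidAlgebra ℂ G)ˣ) : MonoidAlgebra ℂ G) = 1 :=
            congrArg Units.val hw1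
          have h3 := auxRep_apply S hS (aux_ev α β w : (MonoidAlgebra ℂ G)ˣ) ⟨s, hs⟩
          have h4 : (⟨s, hs⟩ : S) = ((aux_ev α β w : (MonoidAlgebra ℂ G)ˣ) : MonoidAlgebra ℂ G) •
              (⟨s, hs⟩ : S) := by
            refine Eq.trans ?_ h3
            exact (LinearMap.congr_fun h2 (⟨s, hs⟩ : S)).symm
          exact (congrArg Subtype.val h4).symm
        by_cases hz : R.char (a * b) = 0
        · refine ⟨_, aux_word_ne, ?_⟩
          obtain ⟨h1, h2⟩ := aux_rels R (hdeg R) a b ha' hb'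
          rw [hz, zero_smul] at h1 h2
          have h3 := (aux_comm_val (by rw [← map_mul, ha', map_zero])
            (by rw [← map_mul, hb', map_zero]) h1 h2
            (Units.map (R.ρ.asAlgebraHom : MonoidAlgebra ℂ G →* Module.End ℂ R.V) α)
            (Units.map (R.ρ.asAlgebraHom : MonoidAlgebra ℂ G →* Module.End ℂ R.V) β)
            (by simp [hα]) (by simp [hβ])).1
          rw [aux_ev_map, map_commutatorElement, map_commutatorElement,
            commutatorElement_eq_one_iff_commute]
          simpa using h3
        · have h := hno R
          rw [aux_free_iff, injective_iff_map_eq_one] at h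
          push Not at h
          obtain ⟨w, hw1, hw⟩ := h
          exact ⟨w, hw, (aux_rep_ev R (hdeg R) a b ha' hb' α β hα hβ hz w).2 hw1⟩
      · intro S T hS hT hbot
        have := hKn S
        have := hKn T
        apply aux_inter (K S) (K T) hS hT
        rw [eq_bot_iff, ← hbot]
        rintro w ⟨h1, h2⟩
        have h1' := (hK S w).1 h1
        have h2' := (hK T w).1 h2
        rw [hK]
        intro s hs
        obtain ⟨p, hp, q, hq, rfl⟩ := Submodule.mem_sup.1 hs
        rw [mul_add, h1' p hp, h2' q hq]
    apply hKtop
    rw [eq_bot_iff]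
    intro w hw
    rw [Subgroup.mem_bot]
    apply (injective_iff_map_eq_one _).1 hfree
    apply Units.ext
    have := (hK ⊤ w).1 hw 1 trivial
    rwa [mul_one] at this
  · -- free point gives a free pair
    rintro ⟨R, hR⟩
    have hz : R.char (a * b) ≠ 0 := by
      intro h
      rw [h] at hR
      exact aux_not_free_zero hR
    rw [aux_free_iff] at hR
    refine (injective_iff_map_eq_one _).2 fun w hw => ?_
    apply (injective_iff_map_eq_one _).1 hR
    rw [← aux_rep_ev R (hdeg R) a b ha' hb' α β hα hβ hz w]
    have hw' : aux_ev α β w = 1 := hw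
    rw [hw', map_one]
  · -- nilpotent implies vanishing
    intro hnil R
    by_contra hz
    apply aux_not_nilp hz
    rw [← aux_ev_range] at hnil ⊢
    have hle : (aux_ev α β).ker ≤ (aux_ev auxU (auxV (R.char (a * b)))).rangeRestrict.ker := by
      intro w hw
      rw [MonoidHom.ker_rangeRestrict, MonoidHom.mem_ker,
        ← aux_rep_ev R (hdeg R) a b ha' hb' α β hα hβ hz w, (MonoidHom.mem_ker).1 hw, map_one]
    have : Group.IsNilpotent (FreeGroup Bool ⧸ (aux_ev α β).ker) :=
      Group.nilpotent_of_mulEquiv (QuotientGroup.quotientKerEquivRange (aux_ev α β)).symm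
    apply Group.nilpotent_of_surjective
      (QuotientGroup.lift _ (aux_ev auxU (auxV (R.char (a * b)))).rangeRestrict hle)
    exact QuotientGroup.lift_surjective_of_surjective _ _
      (MonoidHom.rangeRestrict_surjective _) _
  · -- vanishing implies nilpotent
    intro hall
    have hzero : ∀ r : MonoidAlgebra ℂ G, (∀ R : IrredGRep G, R.ρ.asAlgebraHom r = 0) → r = 0 := by
      intro r hr
      have := aux_simple_ind (R := MonoidAlgebra ℂ G) (fun S => ∀ s ∈ S, r * s = 0) ?_ ?_ ?_
      · simpa using this 1 trivial
      · intro s hs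
        rw [(Submodule.mem_bot _).1 hs, mul_zero]
      · intro S hS s hs
        have h3 := auxRep_apply S hS r ⟨s, hs⟩
        rw [hr] at h3
        exact (congrArg Subtype.val h3).symm
      · intro S T hS hT s hs
        obtain ⟨p, hp, q, hq, rfl⟩ := Submodule.mem_sup.1 hs
        rw [mul_add, hS p hp, hT q hq, add_zero]
    have h1 : a * b * a = 0 := hzero _ fun R => by
      rw [map_mul, map_mul, (aux_rels R (hdeg R) a b ha' hb').1, hall, zero_smul]
    have h2 : b * a * b = 0 := hzero _ fun R => by
      rw [map_mul, map_mul, (aux_rels R (hdeg R) a b ha' hb').2, hall, zero_smul]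
    obtain ⟨c1, c2⟩ := aux_comm_val ha' hb' h1 h2 α β hα hβ
    have hcl : Subgroup.closure {(⟨α, Subgroup.subset_closure (by simp)⟩ : Subgroup.closure {α, β}),
        (⟨β, Subgroup.subset_closure (by simp)⟩ : Subgroup.closure {α, β})} = ⊤ := by
      apply Subgroup.map_injective (Subgroup.subtype_injective _)
      rw [MonoidHom.map_closure, Set.image_pair, ← MonoidHom.range_eq_map, Subgroup.range_subtype]
      rfl
    exact aux_nilp_two hcl (Subtype.ext c1) (Subtype.ext c2)
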